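/- arXiv:1009.0015 — 5 statements merged into one kernel-verified Lean document; each statement's English description precedes it below -/
import Mathlib

section
/- Let n ≥ 1 and let Ψ be a Ψ-tensor on ℝ^n with vector trace Ψv. If for all indices i, j, k one has Ψv i * δ j k + Ψv j * δ i k + Ψ i j k + Ψ j i k = 0, then Ψ i j k = 0 for all i, j, k (and in particular Ψv = 0). (This is the algebraic core of the paper's Lemma on gauge invariance of Ω⁽¹⁾: invariance of Ω⁽¹⁾ under infinitesimal null rotations forces the boost-weight-1 Weyl components Ψ_{ijk} of the background to vanish.) -/
/-- Kronecker delta on `Fin n`. -/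
def δ {n : ℕ} (i j : Fin n) : ℝ := if i = j then 1 else 0

/-- If a Ψ-tensor (antisymmetric in its last two indices and satisfying the
cyclic identity), with vector trace `Ψv`, satisfies
`Ψv i * δ j k + Ψv j * δ i k + Ψ i j k + Ψ j i k = 0` for all indices,
then `Ψ = 0`. -/
theorem psi_vanishes_of_null_rotation_invariance
    (n : ℕ) (hn : 1 ≤ n) (Ψ : Fin n → Fin n → Fin n → ℝ)
    (hanti : ∀ i j k, Ψ i j k = -Ψ i k j)
    (hcyc : ∀ i j k, Ψ i j k + Ψ j k i + Ψ k i j = 0)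
    (Ψv : Fin n → ℝ) (hΨv : ∀ j, Ψv j = ∑ i, Ψ i j i)
    (hinv : ∀ i j k, Ψv i * δ j k + Ψv j * δ i k + Ψ i j k + Ψ j i k = 0) :
    ∀ i j k, Ψ i j k = 0 := by
  have hv : ∀ i, Ψv i = 0 := fun i => by
    have h := hinv i i i
    simp only [δ, if_true] at h
    linarith [hanti i i i]
  have hswap : ∀ i j k, Ψ i j k = -Ψ j i k := fun i j k => by
    have h := hinv i j k
    rw [hv i, hv j] at h
    linarith
  intro i j k
  linarith [hcyc i j k, hswap j k i, hanti k j i, hswap k i j, hanti i k j, hanti j k i,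
    hswap i j k]
end

section
/- Let n ≥ 3 and let S be a Ψ-symmetric 4-tensor on ℝ^n. Define M i j := ∑ k, S k i j k, N i j := ∑ k, S i k j k, t := ∑ k, N k k, and set W i j := (1/(n*(n−2))) * (−(n−1)*(M i j + M j i)/2 + (N i j + N j i)/2 − t * δ i j) + (1/((n+2)*(n−2))) * (−(n−1)*(M i j − M j i)/2 + (N i j − N j i)/2), Y i j := (1/(n*(n−2))) * ((M i j + M j i)/2 − (n−1)*(N i j + N j i)/2 + t * δ i j) + (1/((n+2)*(n−2))) * (3*(M i j − M j i)/2 − (n+1)*(N i j − N j i)/2), X k l := W k l − W l k, Z := t/(n*(n−1)). Define V i j k l := S i j k l − δ i k * W j l + δ i l * W j k − δ i j * X k l − δ j k * Y i l + δ j l * Y i k − (δ i k * δ j l − δ i l * δ j k) * Z. Then: (a) V i j k l = −V i j l k for all indices; (b) V i j k l + V i k l j + V i l j k = 0 for all indices; (c) V is totally traceless: for all a, b, ∑ k, V k a b k = 0, ∑ k, V a k b k = 0, and ∑ k, V k k a b = 0. (This is the irreducible SO(n) decomposition ð_iΨ_{jkl} = V_{ijkl} + 2δ_{i[k}W_{j|l]}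 + δ_{ij}X_{kl} + 2δ_{j[k}Y_{i|l]} + 2δ_{i[k}δ_{j|l]}Z with the paper's explicit formulas, written with n = d−2.) -/
lemma delta_self {n : ℕ} (i : Fin n) : δ i i = 1 := by simp [δ]

lemma delta_comm {n : ℕ} (i j : Fin n) : δ i j = δ j i := by simp [δ, eq_comm]

lemma sum_delta_mul {n : ℕ} (a : Fin n) (f : Fin n → ℝ) : ∑ k, δ k a * f k = f a := by
  simp [δ]

lemma sum_delta_mul' {n : ℕ} (a : Fin n) (f : Fin n → ℝ) : ∑ k, δ a k * f k = f a := by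
  simp [δ]

/-- The irreducible SO(n) decomposition of a Ψ-symmetric 4-tensor
`S` (modelling `ð_iΨ_{jkl}`): subtracting off the explicit trace parts built from
`W`, `X`, `Y`, `Z` leaves a tensor `V` which is antisymmetric in its last two indices,
satisfies the cyclic identity, and is totally traceless. -/
theorem irreducible_decomposition_traceless
    (n : ℕ) (hn : 3 ≤ n) (S : Fin n → Fin n → Fin n → Fin n → ℝ)
    (hanti : ∀ i j k l, S i j k l = -S i j l k)
    (hcyc : ∀ i j k l, S i j k l + S i k l j + S i l j k = 0)
    (M N : Fin n → Fin n → ℝ)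
    (hM : ∀ i j, M i j = ∑ k, S k i j k)
    (hN : ∀ i j, N i j = ∑ k, S i k j k)
    (t : ℝ) (ht : t = ∑ k, N k k)
    (W Y X : Fin n → Fin n → ℝ) (Z : ℝ)
    (hW : ∀ i j, W i j =
      (1/((n : ℝ)*((n : ℝ)-2))) * (-((n : ℝ)-1)*(M i j + M j i)/2 + (N i j + N j i)/2 - t * δ i j)
      + (1/(((n : ℝ)+2)*((n : ℝ)-2))) * (-((n : ℝ)-1)*(M i j - M j i)/2 + (N i j - N j i)/2))
    (hY : ∀ i j, Y i j =
      (1/((n : ℝ)*((n : ℝ)-2))) * ((M i j + M j i)/2 - ((n : ℝ)-1)*(N i j + N j i)/2 + t * δ i j)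
      + (1/(((n : ℝ)+2)*((n : ℝ)-2))) * (3*(M i j - M j i)/2 - ((n : ℝ)+1)*(N i j - N j i)/2))
    (hX : ∀ k l, X k l = W k l - W l k)
    (hZ : Z = t/((n : ℝ)*((n : ℝ)-1)))
    (V : Fin n → Fin n → Fin n → Fin n → ℝ)
    (hV : ∀ i j k l, V i j k l = S i j k l - δ i k * W j l + δ i l * W j k - δ i j * X k l
      - δ j k * Y i l + δ j l * Y i k - (δ i k * δ j l - δ i l * δ j k) * Z) :
    (∀ i j k l, V i j k l = -V i j l k) ∧
    (∀ i j k l, V i j k l + V i k l j + V i l j k = 0) ∧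
    (∀ a b, ∑ k, V k a b k = 0) ∧
    (∀ a b, ∑ k, V a k b k = 0) ∧
    (∀ a b, ∑ k, V k k a b = 0) := by
  have hn' : (3 : ℝ) ≤ n := by exact_mod_cast hn
  have h0 : (n : ℝ) ≠ 0 := by linarith
  have h1 : (n : ℝ) - 1 ≠ 0 := by linarith
  have h2 : (n : ℝ) - 2 ≠ 0 := by linarith
  have h3 : (n : ℝ) + 2 ≠ 0 := by linarith
  have trM : ∑ k, M k k = -t := by
    simp only [ht, hM, hN, ← Finset.sum_neg_distrib]
    rw [Finset.sum_comm]
    exact Finset.sum_congr rfl fun i _ => Finset.sum_congr rfl fun k _ => hanti _ _ _ _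
  have trδ : ∑ k : Fin n, δ k k = (n : ℝ) := by simp [delta_self]
  have trY : ∑ k, Y k k = 0 := by
    simp only [hY, Finset.sum_add_distrib, ← Finset.mul_sum, Finset.sum_sub_distrib,
      ← Finset.sum_div, trM, ← ht, trδ]
    ring
  have trW : ∑ k, W k k = 0 := by
    simp only [hW, Finset.sum_add_distrib, ← Finset.mul_sum, Finset.sum_sub_distrib,
      ← Finset.sum_div, trM, ← ht, trδ]
    ring
  have anti : ∀ i j k l, V i j k l = -V i j l k := by
    intro i j k l
    rw [hV, hV, hanti i j k l, hX, hX]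
    ring
  have cyc : ∀ i j k l, V i j k l + V i k l j + V i l j k = 0 := by
    intro i j k l
    simp only [hV, hX]
    rw [delta_comm k j, delta_comm l j, delta_comm l k]
    linear_combination hcyc i j k l
  have tr₁ : ∀ a b, ∑ k, V k a b k = 0 := by
    intro a b
    have key : ∑ k, V k a b k = M a b - W a b + n * W a b - X b a - δ a b * ∑ k, Y k k
        + Y a b - (δ a b - n * δ a b) * Z := by
      simp only [hV, Finset.sum_add_distrib, Finset.sum_sub_distrib, ← Finset.sum_mul,
        ← Finset.mul_sum, sum_delta_mul, sum_delta_mul', trδ, hM]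
    rw [key, trY, hX, hZ]
    simp only [hW, hY, delta_comm b a]
    field_simp
    ring
  have tr₂ : ∀ a b, ∑ k, V a k b k = 0 := by
    intro a b
    have key : ∑ k, V a k b k = N a b - δ a b * ∑ k, W k k + W a b - X b a
        - Y a b + n * Y a b - (δ a b * n - δ a b) * Z := by
      simp only [hV, Finset.sum_add_distrib, Finset.sum_sub_distrib, ← Finset.sum_mul,
        ← Finset.mul_sum, sum_delta_mul, sum_delta_mul', trδ, hN]
    rw [key, trW, hX, hZ]
    simp only [hW, hY, delta_comm b a]
    field_simp
    ring
  refine ⟨anti, cyc, tr₁, tr₂, fun a b => ?_⟩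
  have h : ∀ k, V k k a b = V k b a k - V k a b k := fun k => by
    linear_combination cyc k k a b - anti k b k a
  simp only [h, Finset.sum_sub_distrib, tr₁, sub_zero]
end

section
/- Let n ≥ 3, let W, Y : Fin n → Fin n → ℝ satisfy ∑ i, W i i = 0 and ∑ i, Y i i = 0, and let Z be a real number. If for all indices i, j, k, l one has δ i k * W j l − δ i l * W j k + δ i j * (W k l − W l k) + δ j k * Y i l − δ j l * Y i k + (δ i k * δ j l − δ i l * δ j k) * Z = 0, then W = 0, Y = 0 and Z = 0. (Uniqueness of the trace part in the irreducible decomposition of ð_iΨ_{jkl}; note this fails for n = 2.) -/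
/-- Uniqueness of the trace part in the irreducible decomposition of
`ð_iΨ_{jkl}`: if the combination of trace terms built from traceless `W`, `Y` and a
scalar `Z` vanishes identically, then `W = 0`, `Y = 0` and `Z = 0` (for `n ≥ 3`). -/
theorem trace_part_uniqueness
    (n : ℕ) (hn : 3 ≤ n) (W Y : Fin n → Fin n → ℝ) (Z : ℝ)
    (hWtr : ∑ i, W i i = 0) (hYtr : ∑ i, Y i i = 0)
    (h : ∀ i j k l, δ i k * W j l - δ i l * W j k + δ i j * (W k l - W l k)
      + δ j k * Y i l - δ j l * Y i k + (δ i k * δ j l - δ i l * δ j k) * Z = 0) :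
    W = 0 ∧ Y = 0 ∧ Z = 0 := by
  have contract_ik : ∀ j l, n * W j l - W l j + Y j l + (n - 1) * (δ j l * Z) = 0 := by
    intro j l
    have e := Finset.sum_eq_zero fun i (_ : i ∈ Finset.univ) => h i j i l
    simp [δ, Finset.sum_add_distrib, Finset.sum_sub_distrib, ← Finset.sum_mul, hYtr] at e
    unfold δ
    split_ifs at e ⊢ <;> linear_combination e
  have contract_jk : ∀ i l, 2 * W i l - W l i + (n - 1) * Y i l - (n - 1) * (δ i l * Z) = 0 := by
    intro i l
    have e := Finset.sum_eq_zero fun j (_ : j ∈ Finset.univ) => h i j j l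
    simp [δ, Finset.sum_add_distrib, Finset.sum_sub_distrib, ← Finset.sum_mul, hWtr] at e
    unfold δ
    split_ifs at e ⊢ <;> linear_combination e
  have hn' : (3 : ℝ) ≤ n := by exact_mod_cast hn
  have hZ : Z = 0 := by
    have e := Finset.sum_eq_zero fun j (_ : j ∈ Finset.univ) => contract_ik j j
    simp [δ, Finset.sum_add_distrib, Finset.sum_sub_distrib, ← Finset.mul_sum, hWtr, hYtr] at e
    rcases e with e | e | e
    · subst e; omega
    · linarith
    · exact e
  subst hZ
  have transpose_eq : ∀ i j, W j i = (n + 1) * W i j := by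
    intro i j
    have e : ((n : ℝ) - 2) * (W j i - (n + 1) * W i j) = 0 := by
      linear_combination contract_jk i j - (n - 1) * contract_ik i j
    rcases mul_eq_zero.mp e with e | e <;> linarith
  have hW : ∀ i j, W i j = 0 := by
    intro i j
    have e : ((n : ℝ) * (n + 2)) * W i j = 0 := by
      linear_combination -transpose_eq j i - (n + 1) * transpose_eq i j
    exact (mul_eq_zero.mp e).resolve_left (by positivity)
  refine ⟨funext₂ hW, funext₂ fun i j => ?_, rfl⟩
  simpa [hW] using contract_ik i j
end

section
/- Let n ≥ 2, let ρ : Fin n → Fin n → ℝ be a matrix with trace r := ∑ k, ρ k k, and let G : Fin n → ℝ. Substituting ðF j := G j and ðF2 i j k := (1/(n−1)) * (δ i j * G k − δ i k * G j) (the pure 'vector' trace part of ð_iF_{jk}), the expression E i := ∑ j, ρ j i * ðF j − ∑ j k, ρ k i * ðF2 j j k + 2 * ∑ j, ρ i j * ðF j + ∑ j k, ρ k j * ðF2 j i k − ∑ j k, ρ j k * ðF2 i j k + ∑ j k, ρ j k * ðF2 j i k satisfies E i = (2/(n−1)) * ∑ j, (ρ j i + (n−1) * ρ i j − r * δ i j)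 * G j for every i. (With n = d−2 this is the reduction of the obstruction terms ρ ð F in the Maxwell decoupling analysis to (2/(d−3))(ρ_{ji} + (d−3)ρ_{ij} − ρδ_{ij})ð_jF.) -/
/-- Reduction of the obstruction terms `ρ ð F` in the Maxwell decoupling
analysis: substituting `ðF j = G j` and
`ðF2 i j k = (1/(n−1)) (δ i j G k − δ i k G j)` into the expression `E i` yields
`E i = (2/(n−1)) ∑ j (ρ j i + (n−1) ρ i j − r δ i j) G j`. -/
theorem maxwell_obstruction_reduction
    (n : ℕ) (hn : 2 ≤ n) (ρ : Fin n → Fin n → ℝ) (G : Fin n → ℝ)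
    (r : ℝ) (hr : r = ∑ k, ρ k k)
    (dF : Fin n → ℝ) (hdF : ∀ j, dF j = G j)
    (dF2 : Fin n → Fin n → Fin n → ℝ)
    (hdF2 : ∀ i j k, dF2 i j k = (1/((n : ℝ) - 1)) * (δ i j * G k - δ i k * G j))
    (E : Fin n → ℝ)
    (hE : ∀ i, E i = ∑ j, ρ j i * dF j - ∑ j, ∑ k, ρ k i * dF2 j j k
      + 2 * ∑ j, ρ i j * dF j + ∑ j, ∑ k, ρ k j * dF2 j i k
      - ∑ j, ∑ k, ρ j k * dF2 i j k + ∑ j, ∑ k, ρ j k * dF2 j i k) :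
    ∀ i, E i = (2/((n : ℝ) - 1)) *
      ∑ j, (ρ j i + ((n : ℝ) - 1) * ρ i j - r * δ i j) * G j := by
  have hn0 : (n : ℝ) - 1 ≠ 0 := by
    have : (2 : ℝ) ≤ n := by exact_mod_cast hn
    linarith
  intro i
  have trace_swap : ∑ j, ∑ k, ρ k i * dF2 j j k = ∑ j, ρ j i * G j := by
    rw [Finset.sum_comm]
    refine Finset.sum_congr rfl fun k _ => ?_
    simp only [hdF2, δ, ← Finset.mul_sum, Finset.sum_sub_distrib]
    simp
    left
    field_simp
  have contract_left : ∑ j, ∑ k, ρ k j * dF2 j i k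
      = 1 / ((n : ℝ) - 1) * (∑ j, ρ j i * G j - r * G i) := by
    simp [hdF2, δ, hr, mul_sub, mul_left_comm _ (((n : ℝ) - 1)⁻¹), Finset.sum_sub_distrib,
      ← Finset.mul_sum, Finset.sum_mul]
  have contract_outer : ∑ j, ∑ k, ρ j k * dF2 i j k
      = 1 / ((n : ℝ) - 1) * (∑ j, ρ i j * G j - ∑ j, ρ j i * G j) := by
    simp [hdF2, δ, mul_sub, mul_left_comm _ (((n : ℝ) - 1)⁻¹), Finset.sum_sub_distrib,
      ← Finset.mul_sum]
  have contract_right : ∑ j, ∑ k, ρ j k * dF2 j i k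
      = 1 / ((n : ℝ) - 1) * (∑ j, ρ i j * G j - r * G i) := by
    simp [hdF2, δ, hr, mul_sub, mul_left_comm _ (((n : ℝ) - 1)⁻¹), Finset.sum_sub_distrib,
      ← Finset.mul_sum, Finset.sum_mul]
  have expand : ∑ j, (ρ j i + ((n : ℝ) - 1) * ρ i j - r * δ i j) * G j
      = ∑ j, ρ j i * G j + ((n : ℝ) - 1) * ∑ j, ρ i j * G j - r * G i := by
    simp [δ, add_mul, sub_mul, Finset.sum_add_distrib, Finset.sum_sub_distrib, Finset.mul_sum,
      mul_assoc]
  rw [hE, trace_swap, contract_left, contract_outer, contract_right, expand]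
  simp only [hdF]
  field_simp
  ring
end

section
/- Let n ≥ 1 and let Ψ be a Ψ-tensor on ℝ^n with vector trace Ψv. Define TΨ i j k := (1/2)*(Ψ i j k + Ψ j i k) + (1/2)*(Ψv i * δ j k + Ψv j * δ i k). Then for all j, k: ∑ i, TΨ i i k = 0 and ∑ i, TΨ i j i = ((n+2)/2) * Ψv j. (With n = d−2 these are the paper's identities T^Ψ_{iik} = 0 and T^Ψ_{iji} = (d/2)Ψ_j.) -/
/-- For a Ψ-tensor `Ψ` with vector trace `Ψv`, the tensor
`TΨ i j k = Ψ_{(ij)k} + Ψ_{(i}δ_{j)k}` satisfies `∑ i, TΨ i i k = 0` and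
`∑ i, TΨ i j i = ((n+2)/2) Ψv j`. -/
theorem TPsi_trace_identities
    (n : ℕ) (hn : 1 ≤ n) (Ψ : Fin n → Fin n → Fin n → ℝ)
    (hanti : ∀ i j k, Ψ i j k = -Ψ i k j)
    (hcyc : ∀ i j k, Ψ i j k + Ψ j k i + Ψ k i j = 0)
    (Ψv : Fin n → ℝ) (hΨv : ∀ j, Ψv j = ∑ i, Ψ i j i)
    (TΨ : Fin n → Fin n → Fin n → ℝ)
    (hTΨ : ∀ i j k, TΨ i j k = (1/2) * (Ψ i j k + Ψ j i k)
      + (1/2) * (Ψv i * δ j k + Ψv j * δ i k)) :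
    (∀ k, ∑ i, TΨ i i k = 0) ∧
    (∀ j, ∑ i, TΨ i j i = (((n : ℝ) + 2)/2) * Ψv j) := by
  have hdiag : ∀ j i, Ψ j i i = 0 := fun j i => by linarith [hanti j i i]
  refine ⟨fun k => ?_, fun j => ?_⟩
  · have hterm : ∀ i, TΨ i i k = -Ψ i k i + Ψv i * δ i k := fun i => by
      rw [hTΨ, hanti i i k]; ring
    simp [hterm, Finset.sum_add_distrib, ← hΨv, δ]
  · have hterm : ∀ i, TΨ i j i = (1/2) * Ψ i j i + (1/2) * (Ψv i * δ j i) + (1/2) * Ψv j :=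
      fun i => by
        rw [hTΨ, hdiag j i]; simp only [δ, if_true]; ring
    simp only [hterm, Finset.sum_add_distrib, ← Finset.mul_sum, ← hΨv]
    simp [δ]
    ring
end
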